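/- arXiv:1610.05865 — 3 statements merged into one kernel-verified Lean document; each statement's English description precedes it below -/
import Mathlib

section
/- Let Δ(τ) = η(τ)²⁴ and let f : ℍ → ℂ be defined by f(τ) = (1/204204)·( (E₆(τ)² + 462·Δ(τ))·(DE₄)(τ)/(240·η(τ)³⁴) − Δ(τ)·E₆(τ)/η(τ)³⁴ ), where (DE₄)(τ) = 240∑_{n≥1} n·σ₃(n)qⁿ. Then f is holomorphic on ℍ and satisfies the second-order modular linear differential equation D²f − (1/6)·E₂·Df − (323/144)·E₄·f = 0 on ℍ (this is the MLDE of weight 0 with parameter h = 18, since (h−1)(h+1)/144 = 323/144). (In the paper, f is the normalized character of the simple affine vertex algebra V_{−4}(E₇).) -/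
noncomputable section

open Complex

/-- `q = exp(2πiτ)`. -/
def qc (τ : ℂ) : ℂ := Complex.exp (2 * (Real.pi : ℂ) * Complex.I * τ)

/-- `σ_k(n) = ∑_{d ∣ n} d^k`, as a complex number. -/
def sigmaC (k n : ℕ) : ℂ := ∑ d ∈ n.divisors, (d : ℂ) ^ k

/-- Eisenstein series `E₂(τ) = 1 - 24 ∑_{n≥1} σ₁(n) qⁿ`. -/
def E2 (τ : ℂ) : ℂ := 1 - 24 * ∑' n : ℕ, sigmaC 1 (n + 1) * qc τ ^ (n + 1)

/-- Eisenstein series `E₄(τ) = 1 + 240 ∑_{n≥1} σ₃(n) qⁿ`. -/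
def E4 (τ : ℂ) : ℂ := 1 + 240 * ∑' n : ℕ, sigmaC 3 (n + 1) * qc τ ^ (n + 1)

/-- Eisenstein series `E₆(τ) = 1 - 504 ∑_{n≥1} σ₅(n) qⁿ`. -/
def E6 (τ : ℂ) : ℂ := 1 - 504 * ∑' n : ℕ, sigmaC 5 (n + 1) * qc τ ^ (n + 1)

/-- The normalized derivative of `E₄`: `(DE₄)(τ) = 240 ∑_{n≥1} n σ₃(n) qⁿ`. -/
def DE4 (τ : ℂ) : ℂ := 240 * ∑' n : ℕ, ((n : ℂ) + 1) * sigmaC 3 (n + 1) * qc τ ^ (n + 1)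

/-- Dedekind eta function `η(τ) = exp(2πiτ/24) ∏_{n≥1} (1 - qⁿ)`. -/
def dedekindEta (τ : ℂ) : ℂ :=
  Complex.exp (2 * (Real.pi : ℂ) * Complex.I * τ / 24) * ∏' n : ℕ, (1 - qc τ ^ (n + 1))

/-- Normalized derivative `D = (2πi)⁻¹ d/dτ`. -/
def Dop (f : ℂ → ℂ) : ℂ → ℂ := fun τ => (2 * (Real.pi : ℂ) * Complex.I)⁻¹ * deriv f τ

/-- The upper half-plane, as a subset of `ℂ`. -/
def UHP : Set ℂ := {τ : ℂ | 0 < τ.im}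

/-- The modular discriminant `Δ(τ) = η(τ)²⁴`. -/
def Delta (τ : ℂ) : ℂ := dedekindEta τ ^ 24

/-- The normalized character of `V_{-4}(E₇)`. -/
def charE7 (τ : ℂ) : ℂ :=
  (1 / 204204) * ((E6 τ ^ 2 + 462 * Delta τ) * DE4 τ / (240 * dedekindEta τ ^ 34)
    - Delta τ * E6 τ / dedekindEta τ ^ 34)


/-- general q-series -/
def qser (a : ℕ → ℂ) (τ : ℂ) : ℂ := ∑' n : ℕ, a n * qc τ ^ (n + 1)

def PolyB (a : ℕ → ℂ) : Prop := ∃ k : ℕ, ∀ n, ‖a n‖ ≤ ((n : ℝ) + 1) ^ k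

lemma norm_qc (τ : ℂ) : ‖qc τ‖ = Real.exp (-2 * Real.pi * τ.im) := by
  rw [qc, Complex.norm_exp]; congr 1; simp

lemma qc_pow (τ : ℂ) (n : ℕ) : qc τ ^ n = Complex.exp (2 * (Real.pi : ℂ) * Complex.I * n * τ) := by
  rw [qc, ← Complex.exp_nat_mul]; congr 1; ring

lemma summ_poly (k : ℕ) {r : ℝ} (h0 : 0 ≤ r) (h1 : r < 1) :
    Summable fun n : ℕ => ((n : ℝ) + 1) ^ k * r ^ (n + 1) := by
  have := summable_pow_mul_geometric_of_norm_lt_one k (r := r) (by rwa [Real.norm_of_nonneg h0])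
  have := (summable_nat_add_iff 1).mpr this
  simpa using this

lemma summ_qser {a : ℕ → ℂ} (ha : PolyB a) {q : ℂ} (hq : ‖q‖ < 1) :
    Summable fun n : ℕ => a n * q ^ (n + 1) := by
  obtain ⟨k, hk⟩ := ha
  refine Summable.of_norm_bounded (summ_poly k (norm_nonneg _) hq) fun n => ?_
  rw [norm_mul, norm_pow]
  gcongr
  exact hk n

lemma PolyB.mul_n {a : ℕ → ℂ} (ha : PolyB a) : PolyB fun n => ((n : ℂ) + 1) * a n := by
  obtain ⟨k, hk⟩ := ha
  refine ⟨k + 1, fun n => ?_⟩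
  rw [norm_mul, pow_succ, mul_comm]
  have : ‖(n : ℂ) + 1‖ = (n : ℝ) + 1 := by
    have := Complex.norm_natCast (n + 1)
    push_cast at this; exact this
  rw [this]
  gcongr
  exact hk n

lemma PolyB_sigma (k : ℕ) : PolyB fun n => sigmaC k (n + 1) := by
  refine ⟨k + 1, fun n => ?_⟩
  change ‖sigmaC k (n + 1)‖ ≤ _
  rw [sigmaC]
  refine (norm_sum_le _ _).trans ?_
  calc ∑ d ∈ (n + 1).divisors, ‖(d : ℂ) ^ k‖ ≤ ∑ d ∈ (n + 1).divisors, ((n : ℝ) + 1) ^ k := by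
        refine Finset.sum_le_sum fun d hd => ?_
        rw [norm_pow, Complex.norm_natCast]
        gcongr
        have := Nat.divisor_le hd
        exact_mod_cast this
    _ = ((n + 1).divisors.card : ℝ) * ((n : ℝ) + 1) ^ k := by simp
    _ ≤ ((n : ℝ) + 1) * ((n : ℝ) + 1) ^ k := by
        gcongr
        exact_mod_cast Nat.card_divisors_le_self (n + 1)
    _ = _ := by ring

lemma hasDerivAt_qser {a : ℕ → ℂ} (ha : PolyB a) {τ : ℂ} (hτ : 0 < τ.im) :
    HasDerivAt (qser a)
      (2 * (Real.pi : ℂ) * Complex.I * qser (fun n => ((n : ℂ) + 1) * a n) τ) τ := by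
  obtain ⟨k, hk⟩ := ha.mul_n
  set r : ℝ := Real.exp (-2 * Real.pi * (τ.im / 2)) with hr
  have hr1 : r < 1 := by
    rw [hr, Real.exp_lt_one_iff]; nlinarith [Real.pi_pos]
  have hopen : IsOpen {z : ℂ | τ.im / 2 < z.im} :=
    isOpen_lt continuous_const Complex.continuous_im
  have hconn : IsPreconnected {z : ℂ | τ.im / 2 < z.im} :=
    (convex_halfSpace_im_gt _).isPreconnected
  have hmem : τ ∈ {z : ℂ | τ.im / 2 < z.im} := by simp; linarith
  have hqlt : ‖qc τ‖ < 1 := by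
    rw [norm_qc, Real.exp_lt_one_iff]; nlinarith [Real.pi_pos]
  have key := hasDerivAt_tsum_of_isPreconnected
    (u := fun n : ℕ => 2 * Real.pi * (((n : ℝ) + 1) ^ k * r ^ (n + 1)))
    (g := fun (n : ℕ) z => a n * qc z ^ (n + 1))
    (g' := fun (n : ℕ) z => 2 * (Real.pi : ℂ) * Complex.I * ((((n : ℂ) + 1) * a n) * qc z ^ (n + 1)))
    (t := {z : ℂ | τ.im / 2 < z.im}) (y₀ := τ) (y := τ)
    ((summ_poly k (Real.exp_nonneg _) hr1).mul_left _) hopen hconn ?_ ?_ hmem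
    (summ_qser ha hqlt) hmem
  · rw [tsum_mul_left] at key
    exact key
  · intro n y _
    have h1 : HasDerivAt (fun z : ℂ => 2 * (Real.pi : ℂ) * Complex.I * ((n + 1 : ℕ) : ℂ) * z)
        (2 * (Real.pi : ℂ) * Complex.I * ((n + 1 : ℕ) : ℂ)) y := by
      simpa using (hasDerivAt_id y).const_mul (2 * (Real.pi : ℂ) * Complex.I * ((n + 1 : ℕ) : ℂ))
    have h2 := (h1.cexp).const_mul (a n)
    simp only [qc_pow]
    refine HasDerivAt.congr_deriv h2 ?_
    push_cast; ring
  · intro n y hy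
    have hqy : ‖qc y‖ ≤ r := by
      rw [norm_qc, hr, Real.exp_le_exp]
      have : τ.im / 2 < y.im := hy
      nlinarith [Real.pi_pos]
    rw [norm_mul, norm_mul (_ * a n), norm_pow]
    have : ‖2 * (Real.pi : ℂ) * Complex.I‖ = 2 * Real.pi := by
      simp [abs_of_pos Real.pi_pos]
    rw [this]
    gcongr
    exact hk n

open Filter Topology UpperHalfPlane in
lemma tendsto_qser {a : ℕ → ℂ} (ha : PolyB a) :
    Tendsto (fun z : UpperHalfPlane => qser a z) atImInfty (𝓝 0) := by
  obtain ⟨k, hk⟩ := ha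
  have hq : Tendsto (fun z : UpperHalfPlane => qc z) atImInfty (𝓝 0) := by
    have := UpperHalfPlane.qParam_tendsto_atImInfty (h := 1) one_pos
    refine this.congr fun z => ?_
    simp [Function.Periodic.qParam, qc]
  have h := tendsto_tsum_of_dominated_convergence (𝓕 := atImInfty)
    (f := fun (z : UpperHalfPlane) (n : ℕ) => a n * qc z ^ (n + 1)) (g := fun _ => (0 : ℂ))
    (bound := fun n : ℕ => ((n : ℝ) + 1) ^ k * (1 / 2) ^ (n + 1))
    (summ_poly k (by norm_num) (by norm_num)) ?_ ?_
  · simpa [qser] using h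
  · intro n
    have := (hq.pow (n + 1)).const_mul (a n)
    simpa using this
  · have : ∀ᶠ z : UpperHalfPlane in atImInfty, ‖qc z‖ < 1 / 2 := by
      have := hq.norm
      rw [norm_zero] at this
      exact this.eventually_lt_const (by norm_num)
    filter_upwards [this] with z hz n
    rw [norm_mul, norm_pow]
    gcongr
    exact hk n

open UpperHalfPlane

lemma qser_pnat (k : ℕ) (z : ℍ) : ∑' n : ℕ+, (ArithmeticFunction.sigma k n : ℂ) *
    Complex.exp (2 * Real.pi * Complex.I * z) ^ (n : ℕ) = qser (fun n => sigmaC k (n + 1)) z := by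
  rw [tsum_pnat_eq_tsum_succ (f := fun n : ℕ => (ArithmeticFunction.sigma k n : ℂ) *
    Complex.exp (2 * Real.pi * Complex.I * z) ^ n)]
  refine tsum_congr fun n => ?_
  simp [sigmaC, qc, ArithmeticFunction.sigma_apply]

lemma E2_eq (z : ℍ) : EisensteinSeries.E2 z = E2 z := by
  rw [EisensteinSeries.E2_eq_tsum_cexp, qser_pnat]; rfl

lemma bern4 : bernoulli 4 = -1 / 30 := by
  rw [bernoulli_eq_bernoulli'_of_ne_one (by norm_num), bernoulli'_four]
lemma bern5 : bernoulli' 5 = 0 := by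
  rw [bernoulli'_def]
  norm_num [Finset.sum_range_succ, Nat.choose]
lemma bern6 : bernoulli 6 = 1 / 42 := by
  rw [bernoulli_eq_bernoulli'_of_ne_one (by norm_num), bernoulli'_def]
  norm_num [Finset.sum_range_succ, Nat.choose, bern5]

lemma E4_eq (z : ℍ) : ModularForm.E (k := 4) (by norm_num) z = E4 z := by
  rw [EisensteinSeries.q_expansion_bernoulli _ ⟨2, rfl⟩]
  simp only [zpow_natCast]
  rw [qser_pnat, bern4, E4, qser]
  push_cast; ring

lemma E6_eq (z : ℍ) : ModularForm.E (k := 6) (by norm_num) z = E6 z := by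
  rw [EisensteinSeries.q_expansion_bernoulli _ ⟨3, rfl⟩]
  simp only [zpow_natCast]
  rw [qser_pnat, bern6, E6, qser]
  push_cast; ring

lemma eta_eq (τ : ℂ) : dedekindEta τ = ModularForm.eta τ := by
  simp only [dedekindEta, ModularForm.eta, ModularForm.eta_q_eq_pow, Function.Periodic.qParam, qc]
  push_cast; rfl


open Filter Topology
open scoped Manifold MatrixGroups ModularForm

lemma hasDerivAt_E2 {τ : ℂ} (hτ : 0 < τ.im) : HasDerivAt E2 (2 * (Real.pi : ℂ) * Complex.I *
    (-24 * qser (fun n => ((n : ℂ) + 1) * sigmaC 1 (n + 1)) τ)) τ := by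
  have := ((hasDerivAt_qser (PolyB_sigma 1) hτ).const_mul 24).const_sub 1
  refine HasDerivAt.congr_deriv this ?_
  ring

lemma hasDerivAt_E4 {τ : ℂ} (hτ : 0 < τ.im) : HasDerivAt E4 (2 * (Real.pi : ℂ) * Complex.I *
    (240 * qser (fun n => ((n : ℂ) + 1) * sigmaC 3 (n + 1)) τ)) τ := by
  have := ((hasDerivAt_qser (PolyB_sigma 3) hτ).const_mul 240).const_add 1
  refine HasDerivAt.congr_deriv this ?_
  ring

lemma hasDerivAt_E6 {τ : ℂ} (hτ : 0 < τ.im) : HasDerivAt E6 (2 * (Real.pi : ℂ) * Complex.I *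
    (-504 * qser (fun n => ((n : ℂ) + 1) * sigmaC 5 (n + 1)) τ)) τ := by
  have := ((hasDerivAt_qser (PolyB_sigma 5) hτ).const_mul 504).const_sub 1
  refine HasDerivAt.congr_deriv this ?_
  ring

lemma DE4_eq (τ : ℂ) : DE4 τ = 240 * qser (fun n => ((n : ℂ) + 1) * sigmaC 3 (n + 1)) τ := rfl

lemma nd_eq {f : ℂ → ℂ} {F : ℍ → ℂ} (hF : ∀ z : ℍ, F z = f z) {z : ℍ} {c : ℂ}
    (h : HasDerivAt f (2 * (Real.pi : ℂ) * Complex.I * c) z) :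
    Derivative.normalizedDerivOfComplex F z = c := by
  have he : (F ∘ ofComplex) =ᶠ[𝓝 (z : ℂ)] f := by
    filter_upwards [isOpen_upperHalfPlaneSet.mem_nhds z.2] with w hw
    simp [ofComplex_apply_of_im_pos hw, hF]
  rw [Derivative.normalizedDerivOfComplex, he.deriv_eq, h.deriv, ← mul_assoc,
    inv_mul_cancel₀ Complex.two_pi_I_ne_zero, one_mul]

lemma mkMF {k : ℤ} {F : ℍ → ℂ} (hF : MDiff F) (hs : ∀ γ : SL(2, ℤ), F ∣[k] γ = F) {c : ℂ}
    (hb : Tendsto F atImInfty (𝓝 c)) : ∃ f : ModularForm 𝒮ℒ k, ⇑f = F := by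
  refine ⟨{ toFun := F, slash_action_eq' := ?_, holo' := hF, bdd_at_cusps' := ?_ }, rfl⟩
  · rintro A ⟨A, rfl⟩
    exact hs A
  · intro c' hc
    rw [Subgroup.IsArithmetic.isCusp_iff_isCusp_SL2Z] at hc
    rw [OnePoint.isBoundedAt_iff_forall_SL2Z hc]
    intro γ _
    rw [hs]
    exact hb.isBigO_one ℝ

lemma eq_of_rank {k : ℤ} (hk : Module.rank ℂ (ModularForm 𝒮ℒ k) = 1) {F : ℍ → ℂ} (hF : MDiff F)
    (hs : ∀ γ : SL(2, ℤ), F ∣[k] γ = F) {c : ℂ} (hb : Tendsto F atImInfty (𝓝 c))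
    (g : ModularForm 𝒮ℒ k) (hg : Tendsto g atImInfty (𝓝 1)) (z : ℍ) : F z = c * g z := by
  obtain ⟨f, rfl⟩ := mkMF hF hs hb
  have hg0 : g ≠ 0 := by
    rintro rfl
    exact zero_ne_one (tendsto_nhds_unique (tendsto_const_nhds (x := (0 : ℂ))) hg)
  obtain ⟨a, ha⟩ := (finrank_eq_one_iff_of_nonzero' g hg0).mp
    (Module.rank_eq_one_iff_finrank_eq_one.mp hk) f
  have h2 : Tendsto f atImInfty (𝓝 (a * 1)) := by
    rw [← ha]
    exact hg.const_mul a
  rw [mul_one] at h2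
  have := tendsto_nhds_unique h2 hb
  rw [← ha, this]; rfl

lemma tE2 : Tendsto (fun z : ℍ => E2 z) atImInfty (𝓝 1) := by
  have := ((tendsto_qser (PolyB_sigma 1)).const_mul 24).const_sub 1
  rw [mul_zero, sub_zero] at this
  exact this
lemma tE4 : Tendsto (fun z : ℍ => E4 z) atImInfty (𝓝 1) := by
  have := ((tendsto_qser (PolyB_sigma 3)).const_mul 240).const_add 1
  rw [mul_zero, add_zero] at this
  exact this
lemma tE6 : Tendsto (fun z : ℍ => E6 z) atImInfty (𝓝 1) := by
  have := ((tendsto_qser (PolyB_sigma 5)).const_mul 504).const_sub 1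
  rw [mul_zero, sub_zero] at this
  exact this

lemma E4_eq' (z : ℍ) : ModularForm.E₄ z = E4 z := E4_eq z
lemma E6_eq' (z : ℍ) : ModularForm.E₆ z = E6 z := E6_eq z

lemma tE4' : Tendsto ModularForm.E₄ atImInfty (𝓝 1) := tE4.congr fun z => (E4_eq' z).symm
lemma tE6' : Tendsto ModularForm.E₆ atImInfty (𝓝 1) := tE6.congr fun z => (E6_eq' z).symm
lemma tE2' : Tendsto EisensteinSeries.E2 atImInfty (𝓝 1) := tE2.congr fun z => (E2_eq z).symm

lemma slash_of (k : ℤ) (f : ModularForm 𝒮ℒ k) (γ : SL(2, ℤ)) : (f : ℍ → ℂ) ∣[k] γ = f :=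
  f.slash_action_eq' _ ⟨γ, rfl⟩

lemma ram4 (z : ℍ) :
    240 * qser (fun n => ((n : ℂ) + 1) * sigmaC 3 (n + 1)) z = (E2 z * E4 z - E6 z) / 3 := by
  have hD : ∀ z : ℍ, Derivative.normalizedDerivOfComplex ModularForm.E₄ z =
    240 * qser (fun n => ((n : ℂ) + 1) * sigmaC 3 (n + 1)) z :=
      fun z => nd_eq E4_eq' (hasDerivAt_E4 z.2)
  have ht := (tendsto_qser (PolyB_sigma 3).mul_n).const_mul 240
  have ht2 : Tendsto (Derivative.serreDerivative (4 : ℤ) ModularForm.E₄) atImInfty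
      (𝓝 (240 * 0 - ((4 : ℤ) : ℂ) * 12⁻¹ * 1 * 1)) :=
    (ht.congr fun z => (hD z).symm).sub ((tE2'.const_mul _).mul tE4')
  have := eq_of_rank (F := Derivative.serreDerivative (4 : ℤ) ModularForm.E₄)
    ModularForm.levelOne_weight_six_rank_one
    (Derivative.serreDerivative_mdifferentiable _ ModularForm.E₄.holo')
    (fun γ => Derivative.serreDerivative_slash_invariant ModularForm.E₄.holo'
      (slash_of 4 ModularForm.E₄ γ)) ht2 ModularForm.E₆ tE6' z
  rw [Derivative.serreDerivative_apply, hD, E2_eq, E4_eq', E6_eq'] at this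
  push_cast at this
  linear_combination this

lemma ram6 (z : ℍ) :
    -504 * qser (fun n => ((n : ℂ) + 1) * sigmaC 5 (n + 1)) z = (E2 z * E6 z - E4 z ^ 2) / 2 := by
  have hD : ∀ z : ℍ, Derivative.normalizedDerivOfComplex ModularForm.E₆ z =
    -504 * qser (fun n => ((n : ℂ) + 1) * sigmaC 5 (n + 1)) z :=
      fun z => nd_eq E6_eq' (hasDerivAt_E6 z.2)
  have ht := (tendsto_qser (PolyB_sigma 5).mul_n).const_mul (-504)
  have ht2 : Tendsto (Derivative.serreDerivative (6 : ℤ) ModularForm.E₆) atImInfty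
      (𝓝 (-504 * 0 - ((6 : ℤ) : ℂ) * 12⁻¹ * 1 * 1)) :=
    (ht.congr fun z => (hD z).symm).sub ((tE2'.const_mul _).mul tE6')
  have hr : Module.rank ℂ (ModularForm 𝒮ℒ 8) = 1 := by
    have := ModularForm.dimension_level_one 8 ⟨4, rfl⟩
    simpa [Nat.ModEq] using this
  have := eq_of_rank (k := 8) (F := Derivative.serreDerivative (6 : ℤ) ModularForm.E₆) hr
    (Derivative.serreDerivative_mdifferentiable _ ModularForm.E₆.holo')
    (fun γ => Derivative.serreDerivative_slash_invariant ModularForm.E₆.holo'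
      (slash_of 6 ModularForm.E₆ γ)) ht2 (ModularForm.E₄.mul ModularForm.E₄ : ModularForm 𝒮ℒ (4 + 4)) 
      (by have := tE4'.mul tE4'; rw [one_mul] at this; exact this) z
  rw [Derivative.serreDerivative_apply, hD, E2_eq, E6_eq'] at this
  have h8 : (ModularForm.E₄.mul ModularForm.E₄ : ModularForm 𝒮ℒ (4 + 4)) z = E4 z * E4 z := by
    rw [← E4_eq']; rfl
  erw [h8] at this
  push_cast at this
  linear_combination this

lemma ram2_slash (γ : SL(2, ℤ)) :
    (Derivative.normalizedDerivOfComplex EisensteinSeries.E2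
      - (1 / 12 : ℂ) • (EisensteinSeries.E2 * EisensteinSeries.E2)) ∣[(4 : ℤ)] γ =
    (Derivative.normalizedDerivOfComplex EisensteinSeries.E2
      - (1 / 12 : ℂ) • (EisensteinSeries.E2 * EisensteinSeries.E2)) := by
  have hs := EisensteinSeries.E2_slash_action γ
  have h1 := Derivative.normalizedDerivOfComplex_SL_slash (k := 2)
    E2_mdifferentiable (γ := γ)
  have hm := ModularForm.mul_slash_SL2 2 2 γ EisensteinSeries.E2 EisensteinSeries.E2
  rw [show (2 : ℤ) + 2 = 4 from rfl] at h1 hm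
  rw [sub_eq_add_neg, SlashAction.add_slash, SlashAction.neg_slash, ModularForm.SL_smul_slash, hm]
  ext z
  have hden : (γ 1 0 : ℂ) * z + γ 1 1 ≠ 0 := by
    have := UpperHalfPlane.denom_ne_zero γ z
    rwa [ModularGroup.denom_apply] at this
  set p : ℂ := 2 * (Real.pi : ℂ) * Complex.I with hp
  have hp0 : p ≠ 0 := Complex.two_pi_I_ne_zero
  have hα : (1 / (2 * riemannZeta 2) : ℂ) = -12 / p ^ 2 := by
    rw [riemannZeta_two, hp]
    have : (Real.pi : ℂ) ≠ 0 := by exact_mod_cast Real.pi_ne_zero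
    have hI := Complex.I_sq
    rw [mul_pow, mul_pow, hI]
    field_simp
    norm_num
  have hsz : ∀ z : ℍ, (EisensteinSeries.E2 ∣[(2 : ℤ)] γ) z =
      E2 z + 12 / p * ((γ 1 0 : ℂ) * ((γ 1 0 : ℂ) * z + γ 1 1)⁻¹) := by
    intro z
    rw [hs, hα]
    simp only [Pi.sub_apply, Pi.smul_apply, smul_eq_mul, EisensteinSeries.D2,
      ModularGroup.denom_apply, E2_eq, ← hp]
    field_simp
    ring
  have hder : HasDerivAt (fun w : ℂ => E2 w + 12 / p * ((γ 1 0 : ℂ) * ((γ 1 0 : ℂ) * w + γ 1 1)⁻¹))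
      (p * (-24 * qser (fun n => ((n : ℂ) + 1) * sigmaC 1 (n + 1)) z
        - 12 / p ^ 2 * ((γ 1 0 : ℂ) * ((γ 1 0 : ℂ) * z + γ 1 1)⁻¹) ^ 2)) z := by
    have hl : HasDerivAt (fun w : ℂ => (γ 1 0 : ℂ) * w + γ 1 1) (γ 1 0 : ℂ) z := by
      simpa using ((hasDerivAt_id (z : ℂ)).const_mul (γ 1 0 : ℂ)).add_const (γ 1 1 : ℂ)
    have := (hasDerivAt_E2 z.2).add (((hl.inv hden).const_mul (γ 1 0 : ℂ)).const_mul (12 / p))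
    refine HasDerivAt.congr_deriv this ?_
    field_simp
    ring
  have h2 := nd_eq hsz hder
  have h3 : Derivative.normalizedDerivOfComplex EisensteinSeries.E2 z =
    -24 * qser (fun n => ((n : ℂ) + 1) * sigmaC 1 (n + 1)) z :=
      nd_eq E2_eq (hasDerivAt_E2 z.2)
  have h1z := congrFun h1 z
  rw [h2] at h1z
  simp only [Pi.sub_apply, Pi.add_apply, Pi.neg_apply, Pi.smul_apply, Pi.mul_apply, smul_eq_mul,
    hsz, h3, E2_eq, ModularGroup.denom_apply] at h1z ⊢
  push_cast at h1z
  linear_combination -h1z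

lemma ram2 (z : ℍ) :
    -24 * qser (fun n => ((n : ℂ) + 1) * sigmaC 1 (n + 1)) z = (E2 z ^ 2 - E4 z) / 12 := by
  have hD : ∀ z : ℍ, Derivative.normalizedDerivOfComplex EisensteinSeries.E2 z =
    -24 * qser (fun n => ((n : ℂ) + 1) * sigmaC 1 (n + 1)) z :=
      fun z => nd_eq E2_eq (hasDerivAt_E2 z.2)
  have ht := (tendsto_qser (PolyB_sigma 1).mul_n).const_mul (-24)
  have ht2 : Tendsto (Derivative.normalizedDerivOfComplex EisensteinSeries.E2
      - (1 / 12 : ℂ) • (EisensteinSeries.E2 * EisensteinSeries.E2)) atImInfty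
      (𝓝 (-24 * 0 - (1 / 12 : ℂ) * (1 * 1))) :=
    (ht.congr fun z => (hD z).symm).sub ((tE2'.mul tE2').const_mul _)
  have hm : MDiff (Derivative.normalizedDerivOfComplex EisensteinSeries.E2
      - (1 / 12 : ℂ) • (EisensteinSeries.E2 * EisensteinSeries.E2)) :=
    (Derivative.normalizedDerivOfComplex_mdifferentiable E2_mdifferentiable).sub
      ((E2_mdifferentiable.mul E2_mdifferentiable).const_smul _)
  have := eq_of_rank ModularForm.levelOne_weight_four_rank_one hm ram2_slash ht2
    ModularForm.E₄ tE4' z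
  simp only [Pi.sub_apply, Pi.smul_apply, Pi.mul_apply, smul_eq_mul, hD, E2_eq, E4_eq'] at this
  linear_combination this

lemma hd2 {τ : ℂ} (hτ : 0 < τ.im) :
    HasDerivAt E2 (2 * (Real.pi : ℂ) * Complex.I * ((E2 τ ^ 2 - E4 τ) / 12)) τ := by
  have := hasDerivAt_E2 hτ
  rwa [ram2 ⟨τ, hτ⟩] at this

lemma hd4 {τ : ℂ} (hτ : 0 < τ.im) :
    HasDerivAt E4 (2 * (Real.pi : ℂ) * Complex.I * ((E2 τ * E4 τ - E6 τ) / 3)) τ := by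
  have := hasDerivAt_E4 hτ
  rwa [ram4 ⟨τ, hτ⟩] at this

lemma hd6 {τ : ℂ} (hτ : 0 < τ.im) :
    HasDerivAt E6 (2 * (Real.pi : ℂ) * Complex.I * ((E2 τ * E6 τ - E4 τ ^ 2) / 2)) τ := by
  have := hasDerivAt_E6 hτ
  rwa [ram6 ⟨τ, hτ⟩] at this

lemma eta_ne {τ : ℂ} (hτ : 0 < τ.im) : dedekindEta τ ≠ 0 := by
  rw [eta_eq]; exact ModularForm.eta_ne_zero hτ

lemma hdeta {τ : ℂ} (hτ : 0 < τ.im) :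
    HasDerivAt dedekindEta (2 * (Real.pi : ℂ) * Complex.I * (E2 τ / 24 * dedekindEta τ)) τ := by
  have h := ModularForm.logDeriv_eta_eq_E2 ⟨τ, hτ⟩
  have hn := ModularForm.eta_ne_zero hτ
  have hd := (ModularForm.differentiableAt_eta_of_mem_upperHalfPlaneSet hτ).hasDerivAt
  rw [E2_eq, logDeriv_apply, div_eq_iff hn] at h
  have he : dedekindEta = ModularForm.eta := funext eta_eq
  rw [he]
  refine hd.congr_deriv ?_
  change deriv ModularForm.eta τ = _ at h
  rw [h]
  change _ * E2 τ * _ = _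
  ring

/-- the weight `η⁻³⁴` -/
def wt (τ : ℂ) : ℂ := (dedekindEta τ ^ 34)⁻¹

lemma hdw {τ : ℂ} (hτ : 0 < τ.im) :
    HasDerivAt wt (2 * (Real.pi : ℂ) * Complex.I * (-(17 / 12) * E2 τ * wt τ)) τ := by
  have hn := eta_ne hτ
  have := ((hdeta hτ).pow 34).inv (pow_ne_zero 34 hn)
  refine HasDerivAt.congr_deriv this ?_
  simp only [wt, Pi.pow_apply]
  field_simp
  push_cast
  ring

lemma disc {τ : ℂ} (hτ : 0 < τ.im) : Delta τ = (E4 τ ^ 3 - E6 τ ^ 2) / 1728 := by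
  have := ModularForm.discriminant_eq_E₄_cube_sub_E₆_sq ⟨τ, hτ⟩
  rw [E4_eq', E6_eq'] at this
  rw [Delta, eta_eq]
  exact this

def F0 (τ : ℂ) : ℂ := (1 / 204204) * (((211 / 207360) * E2 τ * E4 τ * E6 τ ^ 2
  - (91 / 207360) * E6 τ ^ 3 + (77 / 207360) * E2 τ * E4 τ ^ 4
  - (197 / 207360) * E4 τ ^ 3 * E6 τ) * wt τ)

def F1 (τ : ℂ) : ℂ := (1 / 204204) * (((3791 / 2488320) * E4 τ ^ 2 * E6 τ ^ 2
  + (221 / 497664) * E4 τ ^ 5 - (187 / 497664) * E2 τ * E6 τ ^ 3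
  - (3961 / 2488320) * E2 τ * E4 τ ^ 3 * E6 τ) * wt τ)

lemma char_eq {τ : ℂ} (hτ : 0 < τ.im) : charE7 τ = F0 τ := by
  have hn := eta_ne hτ
  rw [charE7, DE4_eq, ram4 ⟨τ, hτ⟩, disc hτ, F0, wt]
  simp only
  field_simp
  ring

lemma hF0 {τ : ℂ} (hτ : 0 < τ.im) :
    HasDerivAt F0 (2 * (Real.pi : ℂ) * Complex.I * F1 τ) τ := by
  have h2 := hd2 hτ
  have h4 := hd4 hτ
  have h6 := hd6 hτ
  have := ((((((h2.const_mul (211 / 207360)).mul h4).mul (h6.pow 2)).sub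
    ((h6.pow 3).const_mul (91 / 207360))).add
    ((h2.const_mul (77 / 207360)).mul (h4.pow 4))).sub
    (((h4.pow 3).const_mul (197 / 207360)).mul h6)).mul (hdw hτ) |>.const_mul (1 / 204204)
  refine HasDerivAt.congr_deriv this ?_
  simp only [F1, Pi.pow_apply, Pi.mul_apply, Pi.add_apply, Pi.sub_apply]
  push_cast
  ring

lemma hF1 {τ : ℂ} (hτ : 0 < τ.im) :
    HasDerivAt F1 (2 * (Real.pi : ℂ) * Complex.I *
      ((1 / 6 : ℂ) * E2 τ * F1 τ + (323 / 144 : ℂ) * E4 τ * F0 τ)) τ := by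
  have h2 := hd2 hτ
  have h4 := hd4 hτ
  have h6 := hd6 hτ
  have := (((((((h4.pow 2).const_mul (3791 / 2488320)).mul (h6.pow 2)).add
    ((h4.pow 5).const_mul (221 / 497664))).sub
    ((h2.const_mul (187 / 497664)).mul (h6.pow 3))).sub
    (((h2.const_mul (3961 / 2488320)).mul (h4.pow 3)).mul h6)).mul (hdw hτ)).const_mul (1 / 204204)
  refine HasDerivAt.congr_deriv this ?_
  simp only [F0, F1, Pi.pow_apply, Pi.mul_apply, Pi.add_apply, Pi.sub_apply]
  push_cast
  ring

lemma Dop_of {f g : ℂ → ℂ} {c τ : ℂ} (hτ : 0 < τ.im) (he : ∀ w : ℂ, 0 < w.im → f w = g w)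
    (h : HasDerivAt g (2 * (Real.pi : ℂ) * Complex.I * c) τ) : Dop f τ = c := by
  have he : f =ᶠ[𝓝 τ] g := by
    filter_upwards [isOpen_upperHalfPlaneSet.mem_nhds hτ] with w hw
    exact he w hw
  rw [Dop, he.deriv_eq, h.deriv, ← mul_assoc,
    inv_mul_cancel₀ Complex.two_pi_I_ne_zero, one_mul]

theorem charE7_holo_and_MLDE :
    DifferentiableOn ℂ charE7 UHP ∧
      ∀ τ ∈ UHP,
        Dop (Dop charE7) τ - (1 / 6 : ℂ) * E2 τ * Dop charE7 τ
          - (323 / 144 : ℂ) * E4 τ * charE7 τ = 0 := by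
  have h1 : ∀ w : ℂ, 0 < w.im → Dop charE7 w = F1 w :=
    fun w hw => Dop_of hw (fun _ h => char_eq h) (hF0 hw)
  refine ⟨?_, fun τ hτ => ?_⟩
  · refine DifferentiableOn.congr (f := F0) ?_ fun τ hτ => char_eq hτ
    exact fun τ hτ => (hF0 hτ).differentiableAt.differentiableWithinAt
  · rw [Dop_of hτ h1 (hF1 hτ), h1 τ hτ, char_eq hτ]
    ring
end
end

section
/- Let Δ(τ) = η(τ)²⁴ and let f : ℍ → ℂ be defined by f(τ) = (1/204204)·( (E₆(τ)² + 462·Δ(τ))·(DE₄)(τ)/(240·η(τ)³⁴) − Δ(τ)·E₆(τ)/η(τ)³⁴ ), where (DE₄)(τ) = 240∑_{n≥1} n·σ₃(n)qⁿ. Then f is of vacuum type with leading exponent 19/12: there exists a holomorphic function g on the open unit disk {z ∈ ℂ : |z| < 1} with g(0) = 1 such that f(τ) = exp(2πiτ·19/12)·g(exp(2πiτ)) for all τ ∈ ℍ. (In particular, the low-order terms of the two summands, which individually begin at q^{−5/12}, cancel through two orders so that the q-expansion of f begins at q^{19/12} with coefficient 1; 19/12 = (h∨+1)/12 for h∨ =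 18, the dual Coxeter number of E₇.) -/
noncomputable section

open Complex

open Filter Topology

/-- `f z = a + b z + c z² + o(z²)` as `z → 0`, `z ≠ 0`. -/
def JetAt (f : ℂ → ℂ) (a b c : ℂ) : Prop :=
  ∃ v : ℂ → ℂ, Tendsto v (𝓝[≠] 0) (𝓝 0) ∧
    ∀ᶠ z in 𝓝[≠] (0 : ℂ), f z = a + b * z + c * z ^ 2 + z ^ 2 * v z

lemma tendsto_id_punctured : Tendsto (fun z : ℂ => z) (𝓝[≠] 0) (𝓝 0) :=
  tendsto_nhdsWithin_of_tendsto_nhds tendsto_id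

lemma JetAt.add {f g : ℂ → ℂ} {a b c a' b' c' : ℂ} (hf : JetAt f a b c) (hg : JetAt g a' b' c') :
    JetAt (fun z => f z + g z) (a + a') (b + b') (c + c') := by
  obtain ⟨v, hv, hf⟩ := hf
  obtain ⟨w, hw, hg⟩ := hg
  refine ⟨fun z => v z + w z, by simpa using hv.add hw, ?_⟩
  filter_upwards [hf, hg] with z h1 h2
  rw [h1, h2]; ring

lemma JetAt.mul {f g : ℂ → ℂ} {a b c a' b' c' : ℂ} (hf : JetAt f a b c) (hg : JetAt g a' b' c') :
    JetAt (fun z => f z * g z) (a * a') (a * b' + b * a') (a * c' + b * b' + c * a') := by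
  obtain ⟨v, hv, hf⟩ := hf
  obtain ⟨w, hw, hg⟩ := hg
  refine ⟨fun z => v z * (a' + b' * z + c' * z ^ 2 + z ^ 2 * w z) +
    w z * (a + b * z + c * z ^ 2) + z * (b * c' + c * b') + z ^ 2 * (c * c'), ?_, ?_⟩
  · have hz := tendsto_id_punctured
    have h1 : Tendsto (fun z : ℂ => (z, v z, w z)) (𝓝[≠] 0) (𝓝 (0, 0, 0)) :=
      hz.prodMk_nhds (hv.prodMk_nhds hw)
    have h2 : Continuous (fun p : ℂ × ℂ × ℂ =>
      p.2.1 * (a' + b' * p.1 + c' * p.1 ^ 2 + p.1 ^ 2 * p.2.2) +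
      p.2.2 * (a + b * p.1 + c * p.1 ^ 2) + p.1 * (b * c' + c * b') + p.1 ^ 2 * (c * c')) := by
      fun_prop
    have h3 := (h2.tendsto (0, 0, 0)).comp h1
    simpa using! h3
  · filter_upwards [hf, hg] with z h1 h2
    rw [h1, h2]; ring

lemma JetAt.const (a : ℂ) : JetAt (fun _ => a) a 0 0 :=
  ⟨fun _ => 0, tendsto_const_nhds, by simp⟩

lemma JetAt.id : JetAt (fun z => z) 0 1 0 :=
  ⟨fun _ => 0, tendsto_const_nhds, by simp⟩

lemma JetAt.congr' {f : ℂ → ℂ} {a b c a' b' c' : ℂ} (hf : JetAt f a b c)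
    (ha : a = a') (hb : b = b') (hc : c = c') : JetAt f a' b' c' := by
  subst ha hb hc; exact hf

/-- power series with coefficients of polynomial growth -/
def pser (a : ℕ → ℂ) (z : ℂ) : ℂ := ∑' n : ℕ, a n * z ^ n

lemma pser_summable_bound (k : ℕ) {r : ℝ} (h0 : 0 ≤ r) (hr : r < 1) :
    Summable (fun n : ℕ => ((n : ℝ) + 1) ^ k * r ^ n) := by
  rcases h0.eq_or_lt with h | h
  · subst h
    refine summable_of_ne_finset_zero (s := {0}) (fun n hn => ?_)
    have : n ≠ 0 := by simpa using hn
    simp [this]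
  · have h1 := summable_pow_mul_geometric_of_norm_lt_one k (r := r)
      (by rwa [Real.norm_of_nonneg h0])
    have h2 := ((summable_nat_add_iff 1).mpr h1).mul_right r⁻¹
    refine h2.congr fun n => ?_
    push_cast
    field_simp
    ring

lemma pser_diff (a : ℕ → ℂ) (k : ℕ) (C : ℝ) (ha : ∀ n, ‖a n‖ ≤ C * ((n : ℝ) + 1) ^ k) :
    DifferentiableOn ℂ (pser a) (Metric.ball 0 1) := by
  intro z hz
  have hz' : ‖z‖ < 1 := by simpa using hz
  obtain ⟨r, h1, h2⟩ := exists_between hz'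
  have hr0 : 0 ≤ r := (norm_nonneg z).trans h1.le
  have := Complex.differentiableOn_tsum_of_summable_norm (U := Metric.ball (0 : ℂ) r)
    (F := fun n z => a n * z ^ n)
    ((pser_summable_bound k hr0 h2).mul_left C) (fun n => by fun_prop) Metric.isOpen_ball
    (fun n w hw => by
      have hw' : ‖w‖ < r := by simpa using hw
      rw [norm_mul, norm_pow, ← mul_assoc]
      have h3 := (norm_nonneg _).trans (ha n)
      gcongr
      exact ha n)
  exact (this.differentiableAt (Metric.isOpen_ball.mem_nhds (by simpa using h1))).differentiableWithinAt

lemma pser_summable (a : ℕ → ℂ) (k : ℕ) (C : ℝ) (ha : ∀ n, ‖a n‖ ≤ C * ((n : ℝ) + 1) ^ k)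
    {z : ℂ} (hz : ‖z‖ < 1) : Summable (fun n => a n * z ^ n) := by
  refine Summable.of_norm_bounded ((pser_summable_bound k (norm_nonneg z) hz).mul_left C) fun n => ?_
  rw [norm_mul, norm_pow, ← mul_assoc]
  gcongr
  exact ha n

lemma pser_shift (a : ℕ → ℂ) (k : ℕ) (C : ℝ) (ha : ∀ n, ‖a n‖ ≤ C * ((n : ℝ) + 1) ^ k)
    {z : ℂ} (hz : ‖z‖ < 1) : pser a z = a 0 + a 1 * z + z ^ 2 * pser (fun n => a (n + 2)) z := by
  unfold pser
  rw [← (pser_summable a k C ha hz).sum_add_tsum_nat_add 2, ← tsum_mul_left]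
  simp only [Finset.sum_range_succ, Finset.sum_range_zero]
  congr 1
  · ring
  · congr 1; ext n; ring

lemma pser_jet (a : ℕ → ℂ) (k : ℕ) (C : ℝ) (ha : ∀ n, ‖a n‖ ≤ C * ((n : ℝ) + 1) ^ k) :
    JetAt (pser a) (a 0) (a 1) (a 2) := by
  have hC : 0 ≤ C := by simpa using (norm_nonneg _).trans (ha 0)
  have ha2 : ∀ n, ‖a (n + 2)‖ ≤ (C * 3 ^ k) * ((n : ℝ) + 1) ^ k := by
    intro n
    refine (ha (n + 2)).trans ?_
    rw [mul_assoc, ← mul_pow]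
    push_cast
    gcongr
    linarith [(Nat.cast_nonneg n : (0 : ℝ) ≤ n)]
  have hd := pser_diff (fun n => a (n + 2)) k _ ha2
  have hc : ContinuousAt (pser (fun n => a (n + 2))) 0 :=
    (hd.differentiableAt (Metric.isOpen_ball.mem_nhds (by simp))).continuousAt
  have h0 : pser (fun n => a (n + 2)) 0 = a 2 := by
    unfold pser
    rw [tsum_eq_single 0 (by intro n hn; simp [hn])]
    simp
  refine ⟨fun z => pser (fun n => a (n + 2)) z - a 2, ?_, ?_⟩
  · have := (hc.tendsto.mono_left (nhdsWithin_le_nhds (s := {0}ᶜ))).sub_const (a 2)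
    simpa [h0] using this
  · have : ∀ᶠ z in 𝓝[≠] (0 : ℂ), z ∈ Metric.ball (0 : ℂ) 1 :=
      nhdsWithin_le_nhds (Metric.isOpen_ball.mem_nhds (by simp))
    filter_upwards [this] with z hz
    rw [pser_shift a k C ha (by simpa using hz)]
    ring

lemma sigmaC_bound (k n : ℕ) : ‖sigmaC k n‖ ≤ (n : ℝ) ^ (k + 1) := by
  have : sigmaC k n = ((ArithmeticFunction.sigma k n : ℕ) : ℂ) := by
    simp [sigmaC, ArithmeticFunction.sigma_apply]
  rw [this, Complex.norm_natCast]
  exact_mod_cast ArithmeticFunction.sigma_le_pow_succ k n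

/-- The Euler product. -/
def eulerP (z : ℂ) : ℂ := ∏' n : ℕ, (1 - z ^ (n + 1))

lemma eulerQ_bound {z : ℂ} (hz : ‖z‖ ≤ 1 / 2) :
    ‖∏' n : ℕ, (1 - z ^ (n + 3)) - 1‖ ≤ 4 * ‖z‖ ^ 3 := by
  have hz1 : ‖z‖ < 1 := by linarith
  have hs : Summable (fun n : ℕ => ‖-z ^ (n + 3)‖) := by
    simpa using (summable_nat_add_iff 3).mpr (summable_geometric_of_lt_one (norm_nonneg _) hz1)
  have hm : Multipliable (fun n : ℕ => 1 + -z ^ (n + 3)) := multipliable_one_add_of_summable hs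
  have ht := hm.hasProd
  simp only [← sub_eq_add_neg] at ht
  have hlim := (ht.sub_const 1).norm
  refine le_of_tendsto hlim (Eventually.of_forall fun s => ?_)
  have h1 := Finset.norm_prod_one_add_sub_one_le s (fun n : ℕ => -z ^ (n + 3))
  simp only [← sub_eq_add_neg] at h1
  refine h1.trans ?_
  have hsum : ∑ i ∈ s, ‖-z ^ (i + 3)‖ ≤ 2 * ‖z‖ ^ 3 := by
    refine (hs.sum_le_tsum s (fun _ _ => norm_nonneg _)).trans ?_
    simp only [norm_neg, norm_mul, norm_pow, pow_add]
    rw [tsum_mul_right, tsum_geometric_of_lt_one (norm_nonneg _) hz1]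
    gcongr
    rw [inv_le_comm₀ (by linarith) (by norm_num)]
    linarith
  have h3 : ‖z‖ ^ 3 ≤ (1 / 2) ^ 3 := by gcongr
  set x := ∑ i ∈ s, ‖-z ^ (i + 3)‖ with hx
  have hx0 : 0 ≤ x := Finset.sum_nonneg fun _ _ => norm_nonneg _
  have h4 := Real.abs_exp_sub_one_le (x := x) (by rw [abs_of_nonneg hx0]; linarith)
  rw [abs_of_nonneg hx0] at h4
  linarith [le_abs_self (Real.exp x - 1)]

lemma eulerQ_jet : JetAt (fun z => ∏' n : ℕ, (1 - z ^ (n + 3))) 1 0 0 := by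
  refine ⟨fun z => (∏' n : ℕ, (1 - z ^ (n + 3)) - 1) / z ^ 2, ?_, ?_⟩
  · rw [tendsto_zero_iff_norm_tendsto_zero]
    have hb : ∀ᶠ z in 𝓝[≠] (0 : ℂ), z ∈ Metric.ball (0 : ℂ) (1 / 2) :=
      nhdsWithin_le_nhds (Metric.isOpen_ball.mem_nhds (by simp))
    have h1 : Tendsto (fun z : ℂ => 4 * ‖z‖) (𝓝[≠] 0) (𝓝 0) := by
      simpa using tendsto_id_punctured.norm.const_mul 4
    refine squeeze_zero' (Eventually.of_forall fun _ => norm_nonneg _) ?_ h1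
    filter_upwards [hb, self_mem_nhdsWithin] with z hz hz0
    have hz0 : z ≠ 0 := hz0
    have hp : 0 < ‖z‖ := norm_pos_iff.mpr hz0
    rw [norm_div, norm_pow, div_le_iff₀ (by positivity)]
    refine (eulerQ_bound (by simpa using (Metric.mem_ball.mp hz).le)).trans (le_of_eq ?_)
    ring
  · filter_upwards [self_mem_nhdsWithin] with z hz0
    have hz0 : z ≠ 0 := hz0
    field_simp
    ring

lemma eulerP_split {z : ℂ} (hz : ‖z‖ < 1) :
    eulerP z = (1 - z) * (1 - z ^ 2) * ∏' n : ℕ, (1 - z ^ (n + 3)) := by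
  have hm (m : ℕ) : Multipliable (fun n : ℕ => 1 - z ^ (n + m)) := by
    simp only [sub_eq_add_neg]
    refine multipliable_one_add_of_summable ?_
    simpa using (summable_nat_add_iff m).mpr (summable_geometric_of_lt_one (norm_nonneg _) hz)
  unfold eulerP
  rw [tprod_eq_zero_mul' (f := fun n : ℕ => 1 - z ^ (n + 1)) (by simpa [add_assoc] using hm 2)]
  simp only [add_assoc, zero_add, pow_one, Nat.reduceAdd]
  rw [tprod_eq_zero_mul' (f := fun n : ℕ => 1 - z ^ (n + 2)) (by simpa [add_assoc] using hm 3)]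
  simp only [add_assoc, zero_add, Nat.reduceAdd, mul_assoc]

lemma JetAt.congr_ev {f g : ℂ → ℂ} {a b c : ℂ} (hf : JetAt f a b c)
    (h : ∀ z, ‖z‖ < 1 → g z = f z) : JetAt g a b c := by
  obtain ⟨v, hv, hf⟩ := hf
  refine ⟨v, hv, ?_⟩
  have hb : ∀ᶠ z in 𝓝[≠] (0 : ℂ), z ∈ Metric.ball (0 : ℂ) 1 :=
    nhdsWithin_le_nhds (Metric.isOpen_ball.mem_nhds (by simp))
  filter_upwards [hf, hb] with z h1 h2
  rw [h z (by simpa using h2), h1]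

lemma eulerP_jet : JetAt eulerP 1 (-1) (-1) := by
  have h1 : JetAt (fun z => 1 + (-1) * z) 1 (-1) 0 :=
    ((JetAt.const 1).add ((JetAt.const (-1)).mul JetAt.id)).congr' (by ring) (by ring) (by ring)
  have h2 : JetAt (fun z => 1 + (-1) * (z * z)) 1 0 (-1) :=
    ((JetAt.const 1).add ((JetAt.const (-1)).mul (JetAt.id.mul JetAt.id))).congr'
      (by ring) (by ring) (by ring)
  refine (((h1.mul h2).mul eulerQ_jet).congr' (by ring) (by ring) (by ring)).congr_ev ?_
  intro z hz
  rw [eulerP_split hz]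
  ring

lemma eulerP24_jet : JetAt (fun z => eulerP z ^ 24) 1 (-24) 252 := by
  have h2 : JetAt _ 1 (-2) (-1) :=
    (eulerP_jet.mul eulerP_jet).congr' (by norm_num) (by norm_num) (by norm_num)
  have h3 := h2.mul eulerP_jet
  have h6 := h3.mul h3
  have h12 := h6.mul h6
  have h24 := h12.mul h12
  refine (h24.congr' (by norm_num) (by norm_num) (by norm_num)).congr_ev ?_
  intro z _
  ring

lemma eulerP_ne {z : ℂ} (hz : ‖z‖ < 1) : eulerP z ≠ 0 := by
  have := tprod_one_add_ne_zero_of_summable (f := fun n : ℕ => -z ^ (n + 1)) (fun n h => ?_) ?_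
  · simpa [eulerP, sub_eq_add_neg] using this
  · have h1 : z ^ (n + 1) = 1 := by linear_combination -h
    have h2 : ‖z‖ ^ (n + 1) = 1 := by rw [← norm_pow, h1, norm_one]
    exact absurd h2 (pow_lt_one₀ (norm_nonneg _) hz (by simp)).ne
  · simpa using (summable_nat_add_iff 1).mpr (summable_geometric_of_lt_one (norm_nonneg _) hz)

/-- `E₆` as a function of `q`. -/
def e6q (z : ℂ) : ℂ := 1 - 504 * (z * pser (fun n => sigmaC 5 (n + 1)) z)

/-- `DE₄/(240 q)` as a function of `q`. -/
def d4q (z : ℂ) : ℂ := pser (fun n => ((n : ℂ) + 1) * sigmaC 3 (n + 1)) z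

lemma s5_bound (n : ℕ) : ‖sigmaC 5 (n + 1)‖ ≤ 1 * ((n : ℝ) + 1) ^ 6 := by
  simpa using sigmaC_bound 5 (n + 1)

lemma s3_bound (n : ℕ) : ‖((n : ℂ) + 1) * sigmaC 3 (n + 1)‖ ≤ 1 * ((n : ℝ) + 1) ^ 5 := by
  have h := sigmaC_bound 3 (n + 1)
  have h1 : ‖(n : ℂ) + 1‖ = (n : ℝ) + 1 := by
    have := Complex.norm_natCast (n + 1)
    push_cast at this
    exact this
  rw [norm_mul, h1]
  push_cast at h
  calc ((n : ℝ) + 1) * ‖sigmaC 3 (n + 1)‖ ≤ ((n : ℝ) + 1) * ((n : ℝ) + 1) ^ 4 := by gcongr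
    _ = _ := by ring

lemma e6q_diff : DifferentiableOn ℂ e6q (Metric.ball 0 1) := by
  have := pser_diff _ _ _ s5_bound
  unfold e6q
  fun_prop

lemma d4q_diff : DifferentiableOn ℂ d4q (Metric.ball 0 1) := pser_diff _ _ _ s3_bound

lemma sigmaC_one (k : ℕ) : sigmaC k 1 = 1 := by simp [sigmaC]

lemma sigmaC_two (k : ℕ) : sigmaC k 2 = 1 + 2 ^ k := by
  simp [sigmaC, Nat.Prime.divisors Nat.prime_two]

lemma sigmaC_three (k : ℕ) : sigmaC k 3 = 1 + 3 ^ k := by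
  simp [sigmaC, Nat.Prime.divisors Nat.prime_three]

lemma e6q_jet : JetAt e6q 1 (-504) (-16632) := by
  have h := pser_jet _ _ _ s5_bound
  have h2 := (JetAt.const 1).add ((JetAt.const (-504)).mul (JetAt.id.mul h))
  refine (h2.congr' (by ring) ?_ ?_).congr_ev (fun z _ => by unfold e6q; ring)
  · simp [sigmaC_one]
  · simp [sigmaC_two]; norm_num

lemma d4q_jet : JetAt d4q 1 18 84 := by
  refine (pser_jet _ _ _ s3_bound).congr' ?_ ?_ ?_
  · simp [sigmaC_one]
  · simp [sigmaC_two]; norm_num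
  · simp [sigmaC_three]; norm_num

/-- numerator divided by `q` -/
def numq (z : ℂ) : ℂ :=
  (e6q z ^ 2 + 462 * (z * eulerP z ^ 24)) * d4q z - eulerP z ^ 24 * e6q z

lemma numq_jet : JetAt numq 0 0 204204 := by
  have h := (((e6q_jet.mul e6q_jet).add ((JetAt.const 462).mul (JetAt.id.mul eulerP24_jet))).mul
    d4q_jet).add ((JetAt.const (-1)).mul (eulerP24_jet.mul e6q_jet))
  refine (h.congr' (by norm_num) (by norm_num) (by norm_num)).congr_ev (fun z _ => ?_)
  unfold numq; ring

lemma eulerP_diff : DifferentiableOn ℂ eulerP (Metric.ball 0 1) :=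
  ModularForm.differentiableOn_tprod_one_sub_pow

lemma eulerP_zero : eulerP 0 = 1 := by simp [eulerP]

/-- The function `g`. -/
def gq (z : ℂ) : ℂ := if z = 0 then 1 else numq z / (204204 * z ^ 2 * eulerP z ^ 34)

lemma gq_diff : DifferentiableOn ℂ gq (Metric.ball 0 1) := by
  rw [← Complex.differentiableOn_compl_singleton_and_continuousAt_iff
    (Metric.isOpen_ball.mem_nhds (by simp : (0 : ℂ) ∈ Metric.ball (0 : ℂ) 1))]
  constructor
  · have h : DifferentiableOn ℂ (fun z => numq z / (204204 * z ^ 2 * eulerP z ^ 34))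
        (Metric.ball 0 1 \ {0}) := by
      have h1 := e6q_diff.mono (Set.sdiff_subset (t := {0}))
      have h2 := d4q_diff.mono (Set.sdiff_subset (t := {0}))
      have h3 := eulerP_diff.mono (Set.sdiff_subset (t := {0}))
      refine DifferentiableOn.div ?_ ?_ ?_
      · unfold numq; fun_prop
      · fun_prop
      · rintro z ⟨hz, hz0⟩
        have hz0 : z ≠ 0 := by simpa using hz0
        have := eulerP_ne (z := z) (by simpa using hz)
        exact mul_ne_zero (mul_ne_zero (by norm_num) (pow_ne_zero 2 hz0)) (pow_ne_zero 34 this)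
    refine h.congr ?_
    rintro z ⟨hz, hz0⟩
    have hz0 : z ≠ 0 := by simpa using hz0
    simp [gq, hz0]
  · rw [continuousAt_iff_punctured_nhds]
    obtain ⟨v, hv, hn⟩ := numq_jet
    have hP : Tendsto eulerP (𝓝[≠] 0) (𝓝 1) := by
      have := (eulerP_diff.differentiableAt
        (Metric.isOpen_ball.mem_nhds (by simp : (0 : ℂ) ∈ Metric.ball (0 : ℂ) 1))).continuousAt.tendsto
      rw [eulerP_zero] at this
      exact this.mono_left nhdsWithin_le_nhds
    have hlim : Tendsto (fun z => (204204 + v z) / (204204 * eulerP z ^ 34)) (𝓝[≠] 0) (𝓝 1) := by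
      have := (hv.const_add 204204).div ((hP.pow 34).const_mul 204204) (by norm_num)
      simpa using! this
    have hg0 : gq 0 = 1 := by simp [gq]
    rw [hg0]
    refine hlim.congr' ?_
    filter_upwards [hn, self_mem_nhdsWithin] with z h1 hz0
    have hz0 : z ≠ 0 := hz0
    simp only [gq, hz0, if_false]
    rw [h1, show (0 : ℂ) + 0 * z + 204204 * z ^ 2 + z ^ 2 * v z = z ^ 2 * (204204 + v z) by ring,
      show 204204 * z ^ 2 * eulerP z ^ 34 = z ^ 2 * (204204 * eulerP z ^ 34) by ring,
      mul_div_mul_left _ _ (pow_ne_zero 2 hz0)]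

/-- `charE7` is of vacuum type with leading exponent `19/12`:
`f(τ) = q^(19/12) (1 + ∑_{n≥1} aₙ qⁿ)` with `g(z) = 1 + ∑ aₙ zⁿ` holomorphic on `|z| < 1`. -/
theorem charE7_vacuum_type :
    ∃ g : ℂ → ℂ, DifferentiableOn ℂ g (Metric.ball (0 : ℂ) 1) ∧ g 0 = 1 ∧
      ∀ τ ∈ UHP,
        charE7 τ = Complex.exp (2 * (Real.pi : ℂ) * Complex.I * τ * (19 / 12)) * g (qc τ) := by
  refine ⟨gq, gq_diff, by simp [gq], fun τ hτ => ?_⟩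
  have hτ : 0 < τ.im := hτ
  have hq1 : ‖qc τ‖ < 1 := by
    simpa [qc] using UpperHalfPlane.norm_exp_two_pi_I_lt_one ⟨τ, hτ⟩
  have hq0 : qc τ ≠ 0 := Complex.exp_ne_zero _
  have hP := eulerP_ne hq1
  have hE6 : E6 τ = e6q (qc τ) := by
    unfold E6 e6q pser
    rw [← tsum_mul_left (a := qc τ)]
    congr 3; ext n; ring
  have hD : DE4 τ = 240 * (qc τ * d4q (qc τ)) := by
    unfold DE4 d4q pser
    rw [← tsum_mul_left (a := qc τ)]
    congr 2; ext n; ring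
  set w : ℂ := Complex.exp (2 * (Real.pi : ℂ) * Complex.I * τ / 24) with hw
  have hw0 : w ≠ 0 := Complex.exp_ne_zero _
  have hwq : qc τ = w ^ 24 := by
    rw [hw, ← Complex.exp_nat_mul, qc]; congr 1; push_cast; ring
  have hw19 : Complex.exp (2 * (Real.pi : ℂ) * Complex.I * τ * (19 / 12)) = w ^ 38 := by
    rw [hw, ← Complex.exp_nat_mul]; congr 1; push_cast; ring
  have hη : dedekindEta τ = w * eulerP (qc τ) := rfl
  rw [hw19]
  simp only [charE7, Delta, hE6, hD, hη, gq, hq0, if_false, numq]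
  generalize eulerP (qc τ) = P at *
  generalize e6q (qc τ) = A
  generalize d4q (qc τ) = B
  rw [hwq]
  field_simp
end
end

section
/- Let Δ(τ) = η(τ)²⁴ and let f : ℍ → ℂ be defined by f(τ) = (1/38818159380)·( (E₆(τ)⁴ + 1341·E₆(τ)²·Δ(τ) + 201894·Δ(τ)²)·(DE₄)(τ)/(240·η(τ)⁵⁸) − (E₆(τ)³·Δ(τ) + 879·E₆(τ)·Δ(τ)²)/η(τ)⁵⁸ ), where (DE₄)(τ) = 240∑_{n≥1} n·σ₃(n)qⁿ. Then f is of vacuum type with leading exponent 31/12: there exists a holomorphic function g on the open unit disk {z ∈ ℂ : |z| < 1} with g(0) = 1 such that f(τ) = exp(2πiτ·31/12)·g(exp(2πiτ)) for all τ ∈ ℍ. (In particular, the low-order terms of the two summands, which individually begin at q^{−17/12}, cancel through four orders so that the q-expansion of f begins at q^{31/12} with coefficient 1; 31/12 = (h∨+1)/12 for h∨ = 30, the dual Coxeter number of E₈.) -/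
noncomputable section

open Complex

/-- The normalized character of `V_{-6}(E₈)`. -/
def charE8 (τ : ℂ) : ℂ :=
  (1 / 38818159380) *
    ((E6 τ ^ 4 + 1341 * E6 τ ^ 2 * Delta τ + 201894 * Delta τ ^ 2) * DE4 τ
        / (240 * dedekindEta τ ^ 58)
      - (E6 τ ^ 3 * Delta τ + 879 * E6 τ * Delta τ ^ 2) / dedekindEta τ ^ 58)

open Filter Topology Asymptotics

/-- `f` agrees with an explicit polynomial of degree at most five, modulo `O(z^6)`. -/
def Ap (f : ℂ → ℂ) (a b c d e k : ℂ) : Prop :=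
  (fun z => f z - (a + b * z + c * z ^ 2 + d * z ^ 3 + e * z ^ 4 + k * z ^ 5))
    =O[𝓝 0] (fun z : ℂ => z ^ 6)

lemma bigO_one_of_continuousAt {f : ℂ → ℂ} (hf : ContinuousAt f 0) :
    f =O[𝓝 0] (fun _ : ℂ => (1 : ℂ)) := hf.isBigO_one ℂ

lemma bigO_mul_one {f g : ℂ → ℂ} (hf : f =O[𝓝 0] (fun z : ℂ => z ^ 6))
    (hg : g =O[𝓝 0] (fun _ : ℂ => (1 : ℂ))) :
    (fun z => f z * g z) =O[𝓝 0] (fun z : ℂ => z ^ 6) := by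
  simpa using hf.mul hg

lemma bigO_pow_one : (fun z : ℂ => z ^ 6) =O[𝓝 0] (fun _ : ℂ => (1 : ℂ)) :=
  bigO_one_of_continuousAt (by fun_prop)

lemma Ap.add {f g : ℂ → ℂ} {a b c d e k a' b' c' d' e' k' : ℂ}
    (hf : Ap f a b c d e k) (hg : Ap g a' b' c' d' e' k') {A B C D E K : ℂ}
    (hA : a + a' = A) (hB : b + b' = B) (hC : c + c' = C) (hD : d + d' = D)
    (hE : e + e' = E) (hK : k + k' = K) :
    Ap (fun z => f z + g z) A B C D E K := by
  subst hA hB hC hD hE hK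
  unfold Ap at *
  refine (IsBigO.add hf hg).congr_left fun z => ?_
  ring

lemma Ap.smul {f : ℂ → ℂ} {a b c d e k : ℂ} (t : ℂ)
    (hf : Ap f a b c d e k) {A B C D E K : ℂ}
    (hA : t * a = A) (hB : t * b = B) (hC : t * c = C) (hD : t * d = D)
    (hE : t * e = E) (hK : t * k = K) :
    Ap (fun z => t * f z) A B C D E K := by
  subst hA hB hC hD hE hK
  unfold Ap at *
  refine (IsBigO.const_mul_left hf t).congr_left fun z => ?_
  ring

lemma Ap.mul {f g : ℂ → ℂ} {a b c d e k a' b' c' d' e' k' : ℂ}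
    (hf : Ap f a b c d e k) (hg : Ap g a' b' c' d' e' k') {A B C D E K : ℂ}
    (hA : a * a' = A) (hB : a * b' + b * a' = B) (hC : a * c' + b * b' + c * a' = C)
    (hD : a * d' + b * c' + c * b' + d * a' = D)
    (hE : a * e' + b * d' + c * c' + d * b' + e * a' = E)
    (hK : a * k' + b * e' + c * d' + d * c' + e * b' + k * a' = K) :
    Ap (fun z => f z * g z) A B C D E K := by
  subst hA hB hC hD hE hK
  unfold Ap at *
  have h1 := bigO_mul_one hf (hg.trans bigO_pow_one)
  have h2 := bigO_mul_one hf (bigO_one_of_continuousAt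
    (f := fun z => a' + b' * z + c' * z ^ 2 + d' * z ^ 3 + e' * z ^ 4 + k' * z ^ 5) (by fun_prop))
  have h3 := bigO_mul_one hg (bigO_one_of_continuousAt
    (f := fun z => a + b * z + c * z ^ 2 + d * z ^ 3 + e * z ^ 4 + k * z ^ 5) (by fun_prop))
  have h4 := bigO_mul_one (isBigO_refl (fun z : ℂ => z ^ 6) (𝓝 0)) (bigO_one_of_continuousAt
    (f := fun z => (b * k' + c * e' + d * d' + e * c' + k * b')
      + (c * k' + d * e' + e * d' + k * c') * z + (d * k' + e * e' + k * d') * z ^ 2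
      + (e * k' + k * e') * z ^ 3 + k * k' * z ^ 4) (by fun_prop))
  refine (((h1.add h2).add h3).add h4).congr_left fun z => ?_
  ring

lemma Ap.of_poly (a b c d e k : ℂ) :
    Ap (fun z => a + b * z + c * z ^ 2 + d * z ^ 3 + e * z ^ 4 + k * z ^ 5) a b c d e k := by
  unfold Ap
  refine (isBigO_zero _ _).congr_left fun z => ?_
  ring

lemma Ap.congr' {f g : ℂ → ℂ} {a b c d e k : ℂ} (hf : Ap f a b c d e k)
    (h : ∀ z ∈ Metric.ball (0 : ℂ) 1, f z = g z) : Ap g a b c d e k := by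
  unfold Ap at *
  refine hf.congr' ?_ EventuallyEq.rfl
  filter_upwards [Metric.ball_mem_nhds (0 : ℂ) one_pos] with z hz
  rw [h z hz]

/-- Radius of convergence at least one. -/
def Sm (a : ℕ → ℂ) : Prop := ∀ r : ℝ, 0 < r → r < 1 → Summable fun n => ‖a n‖ * r ^ n

lemma Sm.shift {a : ℕ → ℂ} (h : Sm a) (m : ℕ) : Sm fun n => a (n + m) := by
  intro r h0 h1
  have := ((summable_nat_add_iff m).mpr (h r h0 h1)).mul_right ((r ^ m)⁻¹)
  refine this.congr fun n => ?_
  have : r ^ m ≠ 0 := by positivity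
  rw [pow_add]
  field_simp

lemma Sm.summable {a : ℕ → ℂ} (h : Sm a) {z : ℂ} (hz : z ∈ Metric.ball (0 : ℂ) 1) :
    Summable fun n => a n * z ^ n := by
  have hz' : ‖z‖ < 1 := by simpa using hz
  obtain ⟨r, hr, hr1⟩ := exists_between hz'
  have h0 : 0 < r := (norm_nonneg z).trans_lt hr
  refine Summable.of_norm_bounded (h r h0 hr1) fun n => ?_
  rw [norm_mul, norm_pow]
  gcongr

lemma Sm.diff {a : ℕ → ℂ} (h : Sm a) :
    DifferentiableOn ℂ (fun z => ∑' n, a n * z ^ n) (Metric.ball (0 : ℂ) 1) := by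
  intro z hz
  have hz' : ‖z‖ < 1 := by simpa using hz
  obtain ⟨r, hr, hr1⟩ := exists_between hz'
  have h0 : 0 < r := (norm_nonneg z).trans_lt hr
  have key : DifferentiableOn ℂ (fun z => ∑' n, a n * z ^ n) (Metric.ball (0 : ℂ) r) := by
    refine Complex.differentiableOn_tsum_of_summable_norm (h r h0 hr1)
      (fun n => by fun_prop) Metric.isOpen_ball fun n w hw => ?_
    have hw' : ‖w‖ < r := by simpa using hw
    rw [norm_mul, norm_pow]
    gcongr
  exact (key.differentiableAt (Metric.isOpen_ball.mem_nhds (by simpa using hr))).differentiableWithinAt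

lemma Sm.ap {a : ℕ → ℂ} (h : Sm a) :
    Ap (fun z => ∑' n, a n * z ^ (n + 1)) 0 (a 0) (a 1) (a 2) (a 3) (a 4) := by
  have hd := ((h.shift 5).diff.differentiableAt
    (Metric.ball_mem_nhds (0 : ℂ) one_pos)).continuousAt
  have := bigO_mul_one (isBigO_refl (fun z : ℂ => z ^ 6) (𝓝 0)) (bigO_one_of_continuousAt hd)
  unfold Ap
  refine this.congr' ?_ EventuallyEq.rfl
  filter_upwards [Metric.ball_mem_nhds (0 : ℂ) one_pos] with z hz
  have e1 : ∑' n, a n * z ^ (n + 1) = z * ∑' n, a n * z ^ n := by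
    rw [← tsum_mul_left]
    exact tsum_congr fun n => by ring
  have e2 : ∑' n, a (n + 5) * z ^ (n + 5) = z ^ 5 * ∑' n, a (n + 5) * z ^ n := by
    rw [← tsum_mul_left]
    exact tsum_congr fun n => by ring
  rw [e1, ← (h.summable hz).sum_add_tsum_nat_add 5, e2]
  simp only [Finset.sum_range_succ, Finset.sum_range_zero]
  ring

lemma Sm.diff' {a : ℕ → ℂ} (h : Sm a) :
    DifferentiableOn ℂ (fun z => ∑' n, a n * z ^ (n + 1)) (Metric.ball (0 : ℂ) 1) := by
  refine (DifferentiableOn.mul differentiableOn_id h.diff).congr fun z _ => ?_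
  simp only [Pi.mul_apply, id]
  rw [← tsum_mul_left]
  exact tsum_congr fun n => by ring

lemma Sm.of_bound {a : ℕ → ℂ} (k : ℕ) (h : ∀ n, ‖a n‖ ≤ ((n : ℝ) + 1) ^ k) : Sm a := by
  intro r h0 h1
  have h2 : Summable fun n : ℕ => ((n : ℝ)) ^ k * r ^ n :=
    summable_pow_mul_geometric_of_norm_lt_one k (by rwa [Real.norm_of_nonneg h0.le])
  have h3 := ((summable_nat_add_iff 1).mpr h2).mul_right (r⁻¹)
  refine Summable.of_nonneg_of_le (fun n => by positivity) (fun n => ?_) h3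
  have : ((n + 1 : ℕ) : ℝ) ^ k * r ^ (n + 1) * r⁻¹ = ((n : ℝ) + 1) ^ k * r ^ n := by
    push_cast
    rw [pow_succ r n]
    field_simp
  rw [this]
  gcongr
  exact h n

lemma norm_sigmaC_le (k n : ℕ) : ‖sigmaC k (n + 1)‖ ≤ ((n : ℝ) + 1) ^ (k + 1) := by
  unfold sigmaC
  refine (norm_sum_le _ _).trans ?_
  have : ∀ d ∈ (n + 1).divisors, ‖(d : ℂ) ^ k‖ ≤ ((n : ℝ) + 1) ^ k := by
    intro d hd
    have := Nat.divisor_le hd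
    have h' : (d : ℝ) ≤ (n : ℝ) + 1 := by exact_mod_cast this
    simp only [norm_pow, Complex.norm_natCast]
    gcongr
  refine (Finset.sum_le_card_nsmul _ _ _ this).trans ?_
  rw [nsmul_eq_mul, pow_succ']
  gcongr
  exact_mod_cast Nat.card_divisors_le_self (n + 1)

/-- `E₆` as a function of `q`. -/
def e6 (z : ℂ) : ℂ := 1 - 504 * ∑' n : ℕ, sigmaC 5 (n + 1) * z ^ (n + 1)

/-- `DE₄ / 240` as a function of `q`. -/
def s4 (z : ℂ) : ℂ := ∑' n : ℕ, ((n : ℂ) + 1) * sigmaC 3 (n + 1) * z ^ (n + 1)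

/-- The Euler product. -/
def eP (z : ℂ) : ℂ := ∏' n : ℕ, (1 - z ^ (n + 1))

lemma sm6 : Sm fun n => sigmaC 5 (n + 1) := Sm.of_bound 6 fun n => norm_sigmaC_le 5 n

lemma sm4 : Sm fun n => ((n : ℂ) + 1) * sigmaC 3 (n + 1) := by
  refine Sm.of_bound 5 fun n => ?_
  rw [norm_mul, pow_succ']
  gcongr
  · have : ((n : ℂ) + 1) = ((n + 1 : ℕ) : ℂ) := by push_cast; rfl
    rw [this, Complex.norm_natCast]
    push_cast
    rfl
  · exact norm_sigmaC_le 3 n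

lemma div1 : Nat.divisors 1 = {1} := by decide
lemma div2 : Nat.divisors 2 = {1, 2} := by decide
lemma div3 : Nat.divisors 3 = {1, 3} := by decide
lemma div4 : Nat.divisors 4 = {1, 2, 4} := by decide
lemma div5 : Nat.divisors 5 = {1, 5} := by decide

lemma ap_s4 : Ap s4 0 1 18 84 292 630 := by
  have h := sm4.ap
  have e0 : ((0 : ℕ) + 1 : ℂ) * sigmaC 3 (0 + 1) = 1 := by norm_num [sigmaC]
  have e1 : ((1 : ℕ) + 1 : ℂ) * sigmaC 3 (1 + 1) = 18 := by norm_num [sigmaC, div2]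
  have e2 : ((2 : ℕ) + 1 : ℂ) * sigmaC 3 (2 + 1) = 84 := by norm_num [sigmaC, div3]
  have e3 : ((3 : ℕ) + 1 : ℂ) * sigmaC 3 (3 + 1) = 292 := by norm_num [sigmaC, div4]
  have e4 : ((4 : ℕ) + 1 : ℂ) * sigmaC 3 (4 + 1) = 630 := by norm_num [sigmaC, div5]
  simp only [e0, e1, e2, e3, e4] at h
  exact h

lemma ap_e6 : Ap e6 1 (-504) (-16632) (-122976) (-532728) (-1575504) := by
  have h := sm6.ap
  have e0 : sigmaC 5 (0 + 1) = 1 := by norm_num [sigmaC]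
  have e1 : sigmaC 5 (1 + 1) = 33 := by norm_num [sigmaC, div2]
  have e2 : sigmaC 5 (2 + 1) = 244 := by norm_num [sigmaC, div3]
  have e3 : sigmaC 5 (3 + 1) = 1057 := by norm_num [sigmaC, div4]
  have e4 : sigmaC 5 (4 + 1) = 3126 := by norm_num [sigmaC, div5]
  simp only [e0, e1, e2, e3, e4] at h
  have h1 := (Ap.of_poly 1 0 0 0 0 0).add (h.smul (-504) rfl rfl rfl rfl rfl rfl)
    rfl rfl rfl rfl rfl rfl
  norm_num at h1
  refine h1.congr' fun z _ => ?_
  unfold e6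
  ring

lemma ap_tail : Ap (fun z => ∏' n : ℕ, (1 - z ^ (n + 6))) 1 0 0 0 0 0 := by
  unfold Ap
  refine IsBigO.of_bound 4 ?_
  filter_upwards [Metric.ball_mem_nhds (0 : ℂ) (show (0 : ℝ) < 1 / 2 by norm_num)] with z hz
  have hz' : ‖z‖ < 1 / 2 := by simpa using hz
  have h0 := norm_nonneg z
  have hs : Summable fun n : ℕ => ‖z‖ ^ n :=
    summable_geometric_of_lt_one h0 (by linarith)
  have hs6 : Summable fun n : ℕ => ‖-z ^ (n + 6)‖ := by
    simpa using (summable_nat_add_iff 6).mpr hs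
  have hm : Multipliable fun n : ℕ => (1 + -z ^ (n + 6)) :=
    multipliable_one_add_of_summable hs6
  have hle : ∀ t : Finset ℕ, ∑ n ∈ t, ‖-z ^ (n + 6)‖ ≤ 2 * ‖z‖ ^ 6 := by
    intro t
    refine (hs6.sum_le_tsum t fun _ _ => norm_nonneg _).trans ?_
    have : ∑' n : ℕ, ‖-z ^ (n + 6)‖ = (1 - ‖z‖)⁻¹ * ‖z‖ ^ 6 := by
      simp only [norm_neg, norm_pow]
      simp only [pow_add]
      rw [tsum_mul_right, tsum_geometric_of_lt_one h0 (by linarith)]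
    rw [this]
    gcongr
    rw [inv_le_comm₀ (by linarith) (by norm_num)]
    linarith
  have hb : ∀ t : Finset ℕ, ‖∏ n ∈ t, (1 + -z ^ (n + 6)) - 1‖ ≤ 4 * ‖z‖ ^ 6 := by
    intro t
    refine (t.norm_prod_one_add_sub_one_le _).trans ?_
    have h6 : ‖z‖ ^ 6 ≤ (1 / 2) ^ 6 := by gcongr
    have h6' : 0 ≤ ‖z‖ ^ 6 := by positivity
    have hx : |2 * ‖z‖ ^ 6| ≤ 1 := by
      rw [abs_of_nonneg (by positivity)]
      norm_num at h6 ⊢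
      linarith
    have := Real.abs_exp_sub_one_le hx
    rw [abs_of_nonneg (show 0 ≤ 2 * ‖z‖ ^ 6 by positivity)] at this
    have h3 := Real.exp_le_exp.mpr (hle t)
    have h4 := le_abs_self (Real.exp (2 * ‖z‖ ^ 6) - 1)
    linarith
  have ht := (hm.hasProd.sub_const 1).norm
  have := le_of_tendsto' ht hb
  simpa [sub_eq_add_neg] using this

lemma ap_eP : Ap eP 1 (-1) (-1) 0 0 1 := by
  have h := (((((Ap.of_poly 1 (-1) 0 0 0 0).mul (Ap.of_poly 1 0 (-1) 0 0 0)
    rfl rfl rfl rfl rfl rfl).mul (Ap.of_poly 1 0 0 (-1) 0 0) rfl rfl rfl rfl rfl rfl).mul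
    (Ap.of_poly 1 0 0 0 (-1) 0) rfl rfl rfl rfl rfl rfl).mul (Ap.of_poly 1 0 0 0 0 (-1))
    rfl rfl rfl rfl rfl rfl).mul ap_tail rfl rfl rfl rfl rfl rfl
  norm_num at h
  refine h.congr' fun z hz => ?_
  have hm := ModularForm.multipliable_one_sub_pow (q := z) (by simpa using hz)
  unfold eP
  have hz' : ‖z‖ < 1 := by simpa using hz
  have hs6 : Summable fun n : ℕ => ‖-z ^ (n + 6)‖ := by
    simpa using (summable_nat_add_iff 6).mpr (summable_geometric_of_lt_one (norm_nonneg z) hz')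
  have hm6 : Multipliable fun n : ℕ => (1 - z ^ (n + 5 + 1)) := by
    simpa [sub_eq_add_neg, add_assoc] using multipliable_one_add_of_summable hs6
  rw [← hm6.prod_mul_tprod_nat_mul' (f := fun n : ℕ => 1 - z ^ (n + 1)) (k := 5)]
  simp only [Finset.prod_range_succ, Finset.prod_range_zero]
  ring

lemma eP_ne_zero {z : ℂ} (hz : z ∈ Metric.ball (0 : ℂ) 1) : eP z ≠ 0 := by
  have hz' : ‖z‖ < 1 := by simpa using hz
  have := tprod_one_add_ne_zero_of_summable (f := fun n : ℕ => -z ^ (n + 1)) (fun n h => ?_) ?_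
  · simpa [eP, sub_eq_add_neg] using this
  · have h1 : z ^ (n + 1) = 1 := by linear_combination -h
    have h2 : ‖z‖ ^ (n + 1) = 1 := by rw [← norm_pow, h1, norm_one]
    exact (pow_lt_one₀ (norm_nonneg z) hz' (Nat.succ_ne_zero n)).ne h2
  · simpa using (summable_nat_add_iff 1).mpr (summable_geometric_of_lt_one (norm_nonneg z) hz')

/-- `Δ` as a function of `q`. -/
def dl (z : ℂ) : ℂ := z * eP z ^ 24

lemma ap_dl : Ap dl 0 1 (-24) 252 (-1472) 4830 := by
  have h2 := ap_eP.mul ap_eP rfl rfl rfl rfl rfl rfl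
  have h3 := h2.mul ap_eP rfl rfl rfl rfl rfl rfl
  norm_num at h3
  have h6 := h3.mul h3 rfl rfl rfl rfl rfl rfl
  norm_num at h6
  have h12 := h6.mul h6 rfl rfl rfl rfl rfl rfl
  norm_num at h12
  have h24 := h12.mul h12 rfl rfl rfl rfl rfl rfl
  norm_num at h24
  have h := (Ap.of_poly 0 1 0 0 0 0).mul h24 rfl rfl rfl rfl rfl rfl
  norm_num at h
  refine h.congr' fun z _ => ?_
  unfold dl
  ring

/-- The numerator as a function of `q`. -/
def nm (z : ℂ) : ℂ :=
  (e6 z ^ 4 + 1341 * e6 z ^ 2 * dl z + 201894 * dl z ^ 2) * s4 z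
    - (e6 z ^ 3 * dl z + 879 * e6 z * dl z ^ 2)

lemma ap_nm : Ap nm 0 0 0 0 0 38818159380 := by
  have e2 := ap_e6.mul ap_e6 rfl rfl rfl rfl rfl rfl
  norm_num at e2
  have e3 := e2.mul ap_e6 rfl rfl rfl rfl rfl rfl
  norm_num at e3
  have e4 := e2.mul e2 rfl rfl rfl rfl rfl rfl
  norm_num at e4
  have d2 := ap_dl.mul ap_dl rfl rfl rfl rfl rfl rfl
  norm_num at d2
  have t1 := (e2.mul ap_dl rfl rfl rfl rfl rfl rfl).smul 1341 rfl rfl rfl rfl rfl rfl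
  norm_num at t1
  have t2 := d2.smul 201894 rfl rfl rfl rfl rfl rfl
  norm_num at t2
  have t3 := (e4.add t1 rfl rfl rfl rfl rfl rfl).add t2 rfl rfl rfl rfl rfl rfl
  norm_num at t3
  have t4 := t3.mul ap_s4 rfl rfl rfl rfl rfl rfl
  norm_num at t4
  have t5 := (e3.mul ap_dl rfl rfl rfl rfl rfl rfl).smul (-1) rfl rfl rfl rfl rfl rfl
  norm_num at t5
  have t6 := (ap_e6.mul d2 rfl rfl rfl rfl rfl rfl).smul (-879) rfl rfl rfl rfl rfl rfl
  norm_num at t6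
  have t7 := (t4.add t5 rfl rfl rfl rfl rfl rfl).add t6 rfl rfl rfl rfl rfl rfl
  norm_num at t7
  refine t7.congr' fun z _ => ?_
  unfold nm
  ring

lemma diff_e6 : DifferentiableOn ℂ e6 (Metric.ball (0 : ℂ) 1) := by
  have := sm6.diff'
  unfold e6
  exact (differentiableOn_const _).sub ((differentiableOn_const _).mul this)

lemma diff_s4 : DifferentiableOn ℂ s4 (Metric.ball (0 : ℂ) 1) := sm4.diff'

lemma diff_eP : DifferentiableOn ℂ eP (Metric.ball (0 : ℂ) 1) :=
  ModularForm.differentiableOn_tprod_one_sub_pow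

lemma diff_dl : DifferentiableOn ℂ dl (Metric.ball (0 : ℂ) 1) := by
  have := diff_eP
  unfold dl
  fun_prop

lemma diff_nm : DifferentiableOn ℂ nm (Metric.ball (0 : ℂ) 1) := by
  have := diff_e6
  have := diff_s4
  have := diff_dl
  unfold nm
  fun_prop

/-- The numerator divided by `q^5`. -/
def hm (z : ℂ) : ℂ := if z = 0 then 38818159380 else nm z / z ^ 5

lemma diff_hm : DifferentiableOn ℂ hm (Metric.ball (0 : ℂ) 1) := by
  rw [← Complex.differentiableOn_compl_singleton_and_continuousAt_iff
    (Metric.ball_mem_nhds (0 : ℂ) one_pos)]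
  constructor
  · have h1 : DifferentiableOn ℂ (fun z => nm z / z ^ 5) (Metric.ball (0 : ℂ) 1 \ {0}) := by
      refine (diff_nm.mono Set.sdiff_subset).div (by fun_prop) fun z hz => ?_
      exact pow_ne_zero _ hz.2
    refine h1.congr fun z hz => ?_
    have : z ≠ 0 := hz.2
    simp [hm, this]
  · have hO := ap_nm
    unfold Ap at hO
    have h1 : (fun z => hm z - 38818159380) =O[𝓝 0] (fun z : ℂ => z) := by
      obtain ⟨C, hC⟩ := hO.bound
      refine IsBigO.of_bound C ?_
      filter_upwards [hC] with z hz
      by_cases h0 : z = 0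
      · simp [hm, h0]
      · have hp : 0 < ‖z‖ := norm_pos_iff.mpr h0
        have hp5 : 0 < ‖z‖ ^ 5 := by positivity
        have e : (hm z - 38818159380) * z ^ 5 = nm z - (0 + 0 * z + 0 * z ^ 2 + 0 * z ^ 3
            + 0 * z ^ 4 + 38818159380 * z ^ 5) := by
          simp only [hm, h0, if_false]
          field_simp
          ring
        rw [← e, norm_mul, norm_pow, norm_pow] at hz
        refine le_of_mul_le_mul_right ?_ hp5
        calc _ ≤ _ := hz
          _ = _ := by ring
    have h2 : Tendsto (fun z => hm z - 38818159380) (𝓝 0) (𝓝 0) := h1.trans_tendsto tendsto_id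
    have h3 := h2.add_const 38818159380
    have h4 : hm 0 = 38818159380 := by simp [hm]
    unfold ContinuousAt
    rw [h4]
    simpa using h3

/-- `charE8` is of vacuum type with leading exponent `31/12`:
`f(τ) = q^(31/12) (1 + ∑_{n≥1} aₙ qⁿ)` with `g(z) = 1 + ∑ aₙ zⁿ` holomorphic on `|z| < 1`. -/
theorem charE8_vacuum_type :
    ∃ g : ℂ → ℂ, DifferentiableOn ℂ g (Metric.ball (0 : ℂ) 1) ∧ g 0 = 1 ∧
      ∀ τ ∈ UHP,
        charE8 τ = Complex.exp (2 * (Real.pi : ℂ) * Complex.I * τ * (31 / 12)) * g (qc τ) := by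
  refine ⟨fun z => 1 / 38818159380 * (hm z / eP z ^ 58), ?_, ?_, ?_⟩
  · exact (differentiableOn_const _).mul
      (diff_hm.div (diff_eP.pow 58) fun z hz => pow_ne_zero _ (eP_ne_zero hz))
  · have : eP 0 = 1 := by simp [eP]
    simp [hm, this]
  · intro τ hτ
    have hq0 : qc τ ≠ 0 := Complex.exp_ne_zero _
    have hq : qc τ ∈ Metric.ball (0 : ℂ) 1 := by
      have := UpperHalfPlane.norm_exp_two_pi_I_lt_one ⟨τ, hτ⟩
      simpa [qc] using this
    have hP := eP_ne_zero hq
    set u : ℂ := Complex.exp (2 * (Real.pi : ℂ) * Complex.I * τ / 24) with hu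
    have hu0 : u ≠ 0 := Complex.exp_ne_zero _
    have hqu : qc τ = u ^ 24 := by
      rw [hu, ← Complex.exp_nat_mul, qc]
      congr 1
      push_cast
      ring
    have hv : Complex.exp (2 * (Real.pi : ℂ) * Complex.I * τ * (31 / 12)) = u ^ 62 := by
      rw [hu, ← Complex.exp_nat_mul]
      congr 1
      push_cast
      ring
    have hη : dedekindEta τ = u * eP (qc τ) := rfl
    have hD : Delta τ = dl (qc τ) := by
      rw [Delta, hη, dl, mul_pow, ← hqu]
    have hE : E6 τ = e6 (qc τ) := rfl
    have hDE : DE4 τ = 240 * s4 (qc τ) := rfl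
    have hc : charE8 τ = 1 / 38818159380 * (nm (qc τ) / (u * eP (qc τ)) ^ 58) := by
      rw [charE8, hη, hD, hE, hDE, nm]
      field_simp
    have hh : hm (qc τ) = nm (qc τ) / qc τ ^ 5 := by simp [hm, hq0]
    rw [hc, hv]
    beta_reduce
    rw [hh]
    have h5 : qc τ ^ 5 = u ^ 120 := by rw [hqu]; ring
    rw [h5]
    generalize nm (qc τ) = N
    generalize eP (qc τ) = P at *
    field_simp
end
end
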